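/- arXiv:2009.07269 — 2 statements merged into one kernel-verified Lean document; each statement's English description precedes it below -/
import Mathlib

section
/- Let G = (V, E) be a finite graph (parallel edges allowed), and for each vertex v draw g_v ∼ N(0, I_k) independently. Then E[ ∏_{(v,w)∈E} ⟨g_v, g_w⟩ ] = Σ_{C cycle cover of G} k^{|C|}, where the sum is over partitions of the edge set of G into edge-disjoint cycles and |C| is the number of cycles; in particular this expectation equals 0 if G admits no cycle cover. Consequently E[ ∏_{(v,w)∈E} ⟨g_v, g_w⟩ ] ≤ |E|^{|E|} · k^{c_max(G)}, where c_max(G) is the number of cycles in a largest cycle cover of G. -/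
open MeasureTheory ProbabilityTheory
open scoped BigOperators Classical

/-- The vertex at which a half-edge (an edge together with a choice of one of its two ends)
is attached.  Here `ep e` gives the (ordered pair of) endpoints of the edge `e`. -/
def vertexOf {V E : Type*} (ep : E → V × V) (h : E × Bool) : V :=
  if h.2 then (ep h.1).1 else (ep h.1).2

/-- A cycle cover of the multigraph with edge-endpoint map `ep`: a partition of the edge set
into edge-disjoint cycles (closed walks with no repeated edges), encoded as a fixed-point-free,
vertex-preserving involution `M` of the half-edges.  At each vertex, `M` pairs up the incident
half-edges; following an edge to its other end and then the pairing `M` traverses the closed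
walks, which partition the edge set into cycles. -/
def IsCycleCover {V E : Type*} (ep : E → V × V) (M : Equiv.Perm (E × Bool)) : Prop :=
  (∀ h, M (M h) = h) ∧ (∀ h, M h ≠ h) ∧ (∀ h, vertexOf ep (M h) = vertexOf ep h)

/-- The number of cycles `|C|` of a cycle cover: the number of connected components of the
graph on the edge set in which two edges are adjacent when the cover pairs an end of one with
an end of the other. -/
noncomputable def numCycles {V E : Type*} (ep : E → V × V) (M : Equiv.Perm (E × Bool)) : ℕ :=
  Nat.card (SimpleGraph.fromRel fun e e' : E => ∃ b b' : Bool, M (e, b) = (e', b')).ConnectedComponent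

/-- The moments of the standard Gaussian. -/
def gaussMom : ℕ → ℕ
  | 0 => 1
  | 1 => 0
  | (n + 2) => (n + 1) * gaussMom n

lemma integrable_pow_gauss (n : ℕ) :
    Integrable (fun x : ℝ => x ^ n) (gaussianReal 0 1) := by
  have h := (memLp_id_gaussianReal (μ := 0) (v := 1) n)
  have := h.integrable_norm_pow'
  refine this.mono' (by fun_prop) ?_
  filter_upwards with x
  simp

lemma hasDerivAt_gaussPDF (x : ℝ) :
    HasDerivAt (gaussianPDFReal 0 1) (-(x * gaussianPDFReal 0 1 x)) x := by
  have h1 : HasDerivAt (fun x : ℝ => -(x - 0) ^ 2 / (2 * ((1 : NNReal) : ℝ))) (-x) x := by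
    have := (((hasDerivAt_id x).sub_const 0).pow 2).neg.div_const (2 * ((1 : NNReal) : ℝ))
    convert! this using 1
    simp only [id, sub_zero, NNReal.coe_one]
    norm_num
    ring
  have h2 := (h1.exp).const_mul (Real.sqrt (2 * Real.pi * ((1 : NNReal) : ℝ)))⁻¹
  rw [gaussianPDFReal_def]
  convert! h2 using 1
  ring

lemma integrable_pow_mul_pdf (n : ℕ) :
    Integrable (fun x : ℝ => x ^ n * gaussianPDFReal 0 1 x) := by
  have h := integrable_pow_gauss n
  rw [gaussianReal_of_var_ne_zero 0 one_ne_zero,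
    integrable_withDensity_iff_integrable_smul' (measurable_gaussianPDF 0 1)
      (by simp [gaussianPDF])] at h
  refine h.congr ?_
  filter_upwards with x
  rw [toReal_gaussianPDF, smul_eq_mul, mul_comm]

lemma integral_pow_gauss_eq (n : ℕ) :
    ∫ x, x ^ n ∂(gaussianReal 0 1) = ∫ x : ℝ, x ^ n * gaussianPDFReal 0 1 x := by
  rw [integral_gaussianReal_eq_integral_smul one_ne_zero]
  simp only [smul_eq_mul, mul_comm]

lemma integral_pow_gauss (n : ℕ) :
    ∫ x, x ^ n ∂(gaussianReal 0 1) = gaussMom n := by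
  induction n using Nat.twoStepInduction with
  | zero => simp [gaussMom]
  | one => simp [gaussMom]
  | more n ih _ =>
    have key := integral_mul_deriv_eq_deriv_mul_of_integrable
      (u := fun x : ℝ => x ^ (n + 1)) (u' := fun x => ((n + 1 : ℕ) : ℝ) * x ^ n)
      (v := gaussianPDFReal 0 1) (v' := fun x => -(x * gaussianPDFReal 0 1 x))
      (fun x _ => by simpa using hasDerivAt_pow (n + 1) x) (fun x _ => hasDerivAt_gaussPDF x)
      (by
        refine (integrable_pow_mul_pdf (n + 2)).neg.congr ?_
        filter_upwards with x
        simp; ring)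
      (by
        refine ((integrable_pow_mul_pdf n).const_mul ((n + 1 : ℕ) : ℝ)).congr ?_
        filter_upwards with x
        simp; ring)
      (integrable_pow_mul_pdf (n + 1))
    rw [integral_pow_gauss_eq] at ih ⊢
    have e1 : ∀ x : ℝ, x ^ (n + 1) * -(x * gaussianPDFReal 0 1 x)
        = -(x ^ (n + 2) * gaussianPDFReal 0 1 x) := fun x => by ring
    have e2 : ∀ x : ℝ, ((n + 1 : ℕ) : ℝ) * x ^ n * gaussianPDFReal 0 1 x
        = ((n + 1 : ℕ) : ℝ) * (x ^ n * gaussianPDFReal 0 1 x) := fun x => by ring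
    simp only [e1, e2, integral_neg, integral_const_mul] at key
    rw [neg_inj.mp key, ih, gaussMom]
    push_cast; rfl

lemma gaussMom_two_mul (k : ℕ) : gaussMom (2 * k) * (2 ^ k * k.factorial) = (2 * k).factorial := by
  induction k with
  | zero => simp [gaussMom]
  | succ k ih =>
    have : 2 * (k + 1) = 2 * k + 2 := by ring
    rw [this, gaussMom, Nat.factorial_succ (2 * k + 1), Nat.factorial_succ (2 * k), ← ih,
      Nat.factorial_succ k]
    ring

lemma gaussMom_odd (k : ℕ) : gaussMom (2 * k + 1) = 0 := by
  induction k with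
  | zero => simp [gaussMom]
  | succ k ih =>
    have : 2 * (k + 1) + 1 = 2 * k + 1 + 2 := by ring
    rw [this, gaussMom, ih, mul_zero]

lemma gaussMom_le (m : ℕ) : gaussMom (2 * m) ≤ m ^ m := by
  induction m with
  | zero => simp [gaussMom]
  | succ m ih =>
    have : 2 * (m + 1) = 2 * m + 2 := by ring
    rw [this, gaussMom]
    have h2 : m ≠ 0 → 2 * m ^ m ≤ (m + 1) ^ m := by
      intro hm
      obtain ⟨p, rfl⟩ := Nat.exists_eq_succ_of_ne_zero hm
      have h4 := one_add_mul_le_pow (R := ℝ) (a := 1 / (p + 1)) (by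
        have : (0 : ℝ) ≤ 1 / (p + 1) := by positivity
        linarith) (p + 1)
      have h5 : (1 : ℝ) + 1 / (p + 1) = (p + 1 + 1) / (p + 1) := by field_simp
      rw [h5, div_pow, le_div_iff₀ (by positivity)] at h4
      have h6 : (1 : ℝ) + ((p + 1 : ℕ) : ℝ) * (1 / (p + 1)) = 2 := by
        push_cast; field_simp; norm_num
      rw [h6] at h4
      exact_mod_cast h4
    rcases Nat.eq_zero_or_pos m with rfl | hm
    · simp [gaussMom]
    · calc (2 * m + 1) * gaussMom (2 * m) ≤ (2 * m + 1) * m ^ m := Nat.mul_le_mul_left _ ih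
        _ ≤ (m + 1) * (2 * m ^ m) := by nlinarith [Nat.zero_le (m ^ m)]
        _ ≤ (m + 1) * (m + 1) ^ m := Nat.mul_le_mul_left _ (h2 hm.ne')
        _ = (m + 1) ^ (m + 1) := by ring

/-- Fixed-point free involutions. -/
def IsFPI {α : Type*} (M : Equiv.Perm α) : Prop := (∀ h, M (M h) = h) ∧ ∀ h, M h ≠ h

lemma isFPI_iff {α : Type*} [Fintype α] (M : Equiv.Perm α) :
    IsFPI M ↔ M.cycleType = Multiset.replicate (Fintype.card α / 2) 2 ∧ Even (Fintype.card α) := by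
  have hf : Fintype.card (Function.fixedPoints M) = 0 ↔ ∀ h, M h ≠ h := by
    rw [Fintype.card_eq_zero_iff]
    simp [Function.fixedPoints, Function.IsFixedPt, Set.isEmpty_coe_sort, Set.eq_empty_iff_forall_notMem]
  have hs : M.cycleType.sum ≤ Fintype.card α := by
    rw [Equiv.Perm.sum_cycleType]; exact Finset.card_le_univ _
  rw [M.card_fixedPoints] at hf
  have h2 : M ^ 2 = 1 ↔ ∀ h, M (M h) = h := by
    rw [Equiv.Perm.ext_iff]; simp [pow_two]
  unfold IsFPI
  rw [← hf, ← h2]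
  constructor
  · rintro ⟨h, h'⟩
    have := Equiv.Perm.cycleType_of_pow_prime_eq_one h
    have h3 : M.cycleType.sum = M.cycleType.card * 2 := by
      conv_lhs => rw [this]
      simp
    have h4 : Fintype.card α = M.cycleType.card * 2 := by omega
    refine ⟨?_, ?_⟩
    · rw [h4]; simpa using this
    · rw [h4]; simp
  · rintro ⟨h, h'⟩
    refine ⟨?_, ?_⟩
    · rw [Equiv.Perm.pow_prime_eq_one_iff, h]
      intro c hc
      exact Multiset.eq_of_mem_replicate hc
    · rw [h]; simp
      obtain ⟨r, hr⟩ := h'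
      omega

lemma card_FPI (α : Type*) [Fintype α] :
    Nat.card {M : Equiv.Perm α // IsFPI M} = gaussMom (Fintype.card α) := by
  simp only [isFPI_iff]
  rcases Nat.even_or_odd (Fintype.card α) with he | ho
  · simp only [he, and_true]
    rw [Nat.card_eq_fintype_card, Fintype.card_subtype]
    have := Equiv.Perm.card_of_cycleType_mul_eq α (Multiset.replicate (Fintype.card α / 2) 2)
    obtain ⟨r, hr⟩ := he
    have hr2 : Fintype.card α / 2 = r := by omega
    rw [hr2] at this ⊢
    have h1 : Fintype.card α - (Multiset.replicate r 2).sum = 0 := by simp; omega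
    have h2 : (∏ n ∈ (Multiset.replicate r 2).toFinset,
        ((Multiset.replicate r 2).count n).factorial) = r.factorial := by
      rcases Nat.eq_zero_or_pos r with rfl | hp
      · simp
      · rw [Multiset.toFinset_replicate, if_neg hp.ne']; simp
    rw [h1, h2, if_pos ⟨by simp; omega, fun a ha => (Multiset.eq_of_mem_replicate ha).ge⟩] at this
    rw [hr, ← two_mul, ← gaussMom_two_mul] at this
    rw [hr, ← two_mul]
    have hpos : 0 < 2 ^ r * r.factorial := by positivity
    refine Nat.eq_of_mul_eq_mul_right hpos ?_
    rw [← this]; simp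
  · have hne : ¬ Even (Fintype.card α) := by simpa using ho
    simp only [hne, and_false]
    obtain ⟨r, hr⟩ := ho
    rw [hr, gaussMom_odd]
    simp

lemma card_FPI_fib {α ι : Type*} [Fintype α] [Fintype ι] (f : α → ι) :
    Nat.card {M : Equiv.Perm α // IsFPI M ∧ ∀ a, f (M a) = f a} =
      ∏ i, gaussMom (Fintype.card {a // f a = i}) := by
  simp only [← card_FPI]
  rw [← Nat.card_pi]
  refine Nat.card_congr ⟨fun M i => ⟨M.1.subtypePerm fun a => by rw [M.2.2], ?_, ?_⟩,
    fun g => ⟨DomMulAct.stabilizerEquiv_invFun_aux fun i => (g i).1, ⟨?_, ?_⟩, ?_⟩, ?_, ?_⟩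
  · rintro ⟨a, ha⟩; ext; exact M.2.1.1 a
  · rintro ⟨a, ha⟩ h
    exact M.2.1.2 a (congrArg Subtype.val h)
  · intro a
    change DomMulAct.stabilizerEquiv_invFun (fun i => (g i).1)
      (DomMulAct.stabilizerEquiv_invFun (fun i => (g i).1) a) = a
    rw [DomMulAct.stabilizerEquiv_invFun_eq _ (DomMulAct.comp_stabilizerEquiv_invFun _ a)]
    exact congrArg Subtype.val ((g (f a)).2.1 ⟨a, rfl⟩)
  · intro a h
    exact (g (f a)).2.2 ⟨a, rfl⟩ (Subtype.ext h)
  · intro a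
    exact DomMulAct.comp_stabilizerEquiv_invFun (fun i => (g i).1) a
  · intro M; ext a; rfl
  · intro g
    funext i
    apply Subtype.ext
    ext a
    exact DomMulAct.stabilizerEquiv_invFun_eq (fun i => (g i).1) a.2

lemma prod_half {V : Type*} [Fintype V] {H : Type*} [Fintype H] {k : ℕ} (f : H → V × Fin k)
    (g : V → Fin k → ℝ) :
    ∏ h, g (f h).1 (f h).2 = ∏ v, ∏ j, g v j ^ Fintype.card {h // f h = (v, j)} := by
  rw [← Fintype.prod_prod_type' (f := fun v j => g v j ^ Fintype.card {h // f h = (v, j)}),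
    ← Finset.prod_fiberwise Finset.univ f]
  refine Finset.prod_congr rfl fun i _ => ?_
  rw [Fintype.card_subtype, ← Finset.prod_const]
  refine Finset.prod_congr rfl fun h hh => ?_
  simp at hh
  rw [hh]

lemma wick {V : Type*} [Fintype V] {H : Type*} [Fintype H] {k : ℕ} (f : H → V × Fin k) :
    Integrable (fun g : V → Fin k → ℝ => ∏ h, g (f h).1 (f h).2)
      (Measure.pi fun _ : V => Measure.pi fun _ : Fin k => gaussianReal 0 1) ∧
    ∫ g : V → Fin k → ℝ, ∏ h, g (f h).1 (f h).2
      ∂(Measure.pi fun _ : V => Measure.pi fun _ : Fin k => gaussianReal 0 1) =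
    (Nat.card {M : Equiv.Perm H // IsFPI M ∧ ∀ a, f (M a) = f a} : ℝ) := by
  simp only [prod_half]
  constructor
  · refine Integrable.fintype_prod_dep (f := fun v (x : Fin k → ℝ) =>
      ∏ j, x j ^ Fintype.card {h // f h = (v, j)}) fun v => ?_
    exact Integrable.fintype_prod_dep (f := fun j (x : ℝ) =>
      x ^ Fintype.card {h // f h = (v, j)}) fun j => integrable_pow_gauss _
  · rw [integral_fintype_prod_eq_prod (f := fun v (x : Fin k → ℝ) =>
      ∏ j, x j ^ Fintype.card {h // f h = (v, j)})]
    have h : ∀ v : V, ∫ x : Fin k → ℝ, ∏ j, x j ^ Fintype.card {h // f h = (v, j)}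
        ∂(Measure.pi fun _ : Fin k => gaussianReal 0 1) =
        ∏ j, (gaussMom (Fintype.card {h // f h = (v, j)}) : ℝ) := by
      intro v
      rw [integral_fintype_prod_eq_prod (f := fun j (x : ℝ) =>
        x ^ Fintype.card {h // f h = (v, j)})]
      simp only [integral_pow_gauss]
    simp only [h]
    rw [card_FPI_fib, Fintype.prod_prod_type]
    push_cast
    refine Finset.prod_congr rfl fun v _ => Finset.prod_congr rfl fun j _ => ?_
    congr
    funext a
    exact Subsingleton.elim _ _

lemma isCycleCover_iff {V E : Type*} (ep : E → V × V) (M : Equiv.Perm (E × Bool)) :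
    IsCycleCover ep M ↔ IsFPI M ∧ ∀ h, vertexOf ep (M h) = vertexOf ep h := by
  unfold IsCycleCover IsFPI; tauto

lemma card_colorings {V E : Type*} [Fintype E] (ep : E → V × V)
    (M : Equiv.Perm (E × Bool)) (k : ℕ) :
    Nat.card {c : E → Fin k // ∀ a, c (M a).1 = c a.1} = k ^ numCycles ep M := by
  unfold numCycles
  set G := SimpleGraph.fromRel fun e e' : E => ∃ b b' : Bool, M (e, b) = (e', b') with hG
  have hadj : ∀ c : E → Fin k, (∀ a, c (M a).1 = c a.1) → ∀ e e', G.Reachable e e' → c e = c e' := by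
    intro c hc e e' ⟨w⟩
    induction w with
    | nil => rfl
    | @cons u v _ h _ ih =>
      rw [← ih]
      rw [hG, SimpleGraph.fromRel_adj] at h
      rcases h.2 with ⟨b, b', hb⟩ | ⟨b, b', hb⟩
      · have := hc (u, b); rw [hb] at this; exact this.symm
      · have := hc (v, b); rw [hb] at this; exact this
  have e : {c : E → Fin k // ∀ a, c (M a).1 = c a.1} ≃ (G.ConnectedComponent → Fin k) :=
    { toFun := fun c => fun x => Quot.lift c.1 (fun a b h => hadj c.1 c.2 a b h) x
      invFun := fun d => ⟨fun e => d (G.connectedComponentMk e), by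
        intro a
        by_cases h : (M a).1 = a.1
        · simp only [h]
        · refine congrArg d ?_
          refine (SimpleGraph.ConnectedComponent.eq).2 (SimpleGraph.Adj.reachable ?_)
          rw [hG, SimpleGraph.fromRel_adj]
          exact ⟨h, Or.inr ⟨a.2, (M a).2, rfl⟩⟩⟩
      left_inv := fun c => rfl
      right_inv := fun d => by
        funext x
        induction x using Quot.ind
        rfl }
  rw [Nat.card_congr e, Nat.card_fun]
  simp

lemma moment_eq {V E : Type*} [Fintype V] [Fintype E] [DecidableEq E]
    (k : ℕ) (ep : E → V × V) :
    (∫ g : V → Fin k → ℝ, ∏ e : E, ∑ j : Fin k, g (ep e).1 j * g (ep e).2 j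
        ∂(Measure.pi fun _ : V => Measure.pi fun _ : Fin k => gaussianReal 0 1)) =
      ∑ M ∈ Finset.univ.filter (IsCycleCover ep), (k : ℝ) ^ numCycles ep M := by
  have hexp : ∀ g : V → Fin k → ℝ, ∏ e : E, ∑ j : Fin k, g (ep e).1 j * g (ep e).2 j =
      ∑ c : E → Fin k, ∏ h : E × Bool, g (vertexOf ep h, c h.1).1 (vertexOf ep h, c h.1).2 := by
    intro g
    rw [Fintype.prod_sum]
    refine Finset.sum_congr rfl fun c _ => ?_
    rw [Fintype.prod_prod_type]
    refine Finset.prod_congr rfl fun e _ => ?_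
    simp [vertexOf]
  simp only [hexp]
  rw [integral_finsetSum _ fun c _ => (wick fun h : E × Bool => (vertexOf ep h, c h.1)).1]
  simp only [(wick fun h : E × Bool => (vertexOf ep h, _)).2]
  have h1 : ∀ c : E → Fin k, (Nat.card {M : Equiv.Perm (E × Bool) // IsFPI M ∧
      ∀ a, (vertexOf ep (M a), c (M a).1) = (vertexOf ep a, c a.1)} : ℝ) =
      ∑ M : Equiv.Perm (E × Bool), if IsCycleCover ep M then
        (if ∀ a, c (M a).1 = c a.1 then (1 : ℝ) else 0) else 0 := by
    intro c
    rw [Nat.card_eq_fintype_card, Fintype.card_subtype, ← Finset.sum_boole]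
    refine Finset.sum_congr rfl fun M _ => ?_
    rw [← ite_and, isCycleCover_iff]
    simp only [Prod.mk.injEq, forall_and, and_assoc]
  simp only [h1]
  rw [Finset.sum_comm, Finset.sum_filter]
  refine Finset.sum_congr rfl fun M _ => ?_
  by_cases hM : IsCycleCover ep M
  · simp only [hM, if_true]
    rw [← Nat.cast_pow, ← card_colorings, Nat.card_eq_fintype_card, Fintype.card_subtype,
      ← Finset.sum_boole]
  · simp [hM]

lemma card_covers_le {V E : Type*} [Fintype E] [DecidableEq E] (ep : E → V × V) :
    (Finset.univ.filter (IsCycleCover ep)).card ≤ Fintype.card E ^ Fintype.card E := by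
  refine le_trans ?_ (gaussMom_le (Fintype.card E))
  have : 2 * Fintype.card E = Fintype.card (E × Bool) := by simp [mul_comm]
  rw [this, ← card_FPI, Nat.card_eq_fintype_card, Fintype.card_subtype]
  refine Finset.card_le_card fun M hM => ?_
  simp only [Finset.mem_filter, Finset.mem_univ, true_and] at hM ⊢
  exact ((isCycleCover_iff ep M).1 hM).1

lemma numCycles_zero {V E : Type*} [Fintype E] (ep : E → V × V) (M M' : Equiv.Perm (E × Bool))
    (h : numCycles ep M = 0) : numCycles ep M' = 0 := by
  unfold numCycles at *
  rcases isEmpty_or_nonempty E with hE | hE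
  · rw [Nat.card_eq_zero]
    left
    exact ⟨fun x => Quot.ind (β := fun _ => False) (fun e => hE.elim e) x⟩
  · exfalso
    rw [Nat.card_eq_zero] at h
    rcases h with h | h
    · exact h.elim (SimpleGraph.connectedComponentMk _ hE.some)
    · exact h.not_finite (Quot.finite _)

/-- Let `G = (V, E)` be a finite graph (parallel edges allowed) with endpoint
map `ep`, and for each vertex `v` draw `g_v ∼ N(0, I_k)` independently.  Then
`E[∏_{(v,w)∈E} ⟨g_v, g_w⟩] = Σ_{C cycle cover of G} k^{|C|}` (in particular `0` if `G` admits
no cycle cover), and consequently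
`E[∏_{(v,w)∈E} ⟨g_v, g_w⟩] ≤ |E|^{|E|} · k^{c_max(G)}` where `c_max(G)` is the number of
cycles in a largest cycle cover (with the convention `c_max = 0` if there is none). -/
theorem gaussian_graph_moment_eq_sum_cycle_covers
    (V E : Type*) [Fintype V] [Fintype E] [DecidableEq V] [DecidableEq E]
    (k : ℕ) (ep : E → V × V) :
    (∫ g : V → Fin k → ℝ, ∏ e : E, ∑ j : Fin k, g (ep e).1 j * g (ep e).2 j
        ∂(Measure.pi fun _ : V => Measure.pi fun _ : Fin k => gaussianReal 0 1)) =
      (∑ M ∈ Finset.univ.filter (IsCycleCover ep), (k : ℝ) ^ numCycles ep M) ∧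
    (∫ g : V → Fin k → ℝ, ∏ e : E, ∑ j : Fin k, g (ep e).1 j * g (ep e).2 j
        ∂(Measure.pi fun _ : V => Measure.pi fun _ : Fin k => gaussianReal 0 1)) ≤
      (Fintype.card E : ℝ) ^ (Fintype.card E) *
        (k : ℝ) ^ ((Finset.univ.filter (IsCycleCover ep)).sup (numCycles ep)) := by
  rw [moment_eq]
  refine ⟨rfl, ?_⟩
  have hb : ∀ M ∈ Finset.univ.filter (IsCycleCover ep), (k : ℝ) ^ numCycles ep M ≤
      (k : ℝ) ^ ((Finset.univ.filter (IsCycleCover ep)).sup (numCycles ep)) := by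
    intro M hM
    have hle := Finset.le_sup (f := numCycles ep) hM
    rcases Nat.eq_zero_or_pos k with rfl | hk
    · rcases Nat.eq_zero_or_pos (numCycles ep M) with h0 | h0
      · have hs : (Finset.univ.filter (IsCycleCover ep)).sup (numCycles ep) = 0 := by
          rw [← Nat.bot_eq_zero, Finset.sup_eq_bot_iff]
          intro M' _
          exact numCycles_zero ep M M' h0
        rw [h0, hs]
      · rw [Nat.cast_zero, zero_pow h0.ne']
        positivity
    · exact pow_le_pow_right₀ (by exact_mod_cast hk) hle
  refine (Finset.sum_le_card_nsmul _ _ _ hb).trans ?_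
  rw [nsmul_eq_mul]
  refine mul_le_mul_of_nonneg_right ?_ (by positivity)
  exact_mod_cast card_covers_le ep
end

section
/- Let ν(k) be defined by log cosh(x) = Σ_{k≥0} ν(k)x^k/k!, and for even m ≥ 4 let μ_star(m) denote the alternating sum over good trees on m leaves weighted by rooted decompositions, satisfying the recursion 2ν(m) = 1{m=2} + Σ_{π ∈ Part([m−1]; odd)} (−μ_star(|π|+1)) ∏_{S∈π} ν(|S|+1) for all even m ≥ 2, with μ_star(2) := −1. Then μ_star(m) = (m−2)! for all even m ≥ 4. Equivalently, the formal power series F(y) = Σ_{k≥1} μ_star(2k) y^{2k}/(2k)! satisfies F'(y) = tanh^{-1}(y) − 2y, i.e., F(y) = −y²/2 + Σ_{k≥2} y^{2k}/(2k(2k−1)). -/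
open scoped BigOperators Classical

/-- `P` is a set partition of `{1, …, d}` (encoded as `Fin d`) all of whose parts have odd
size. -/
def IsOddPartition (d : ℕ) (P : Finset (Finset (Fin d))) : Prop :=
  ∅ ∉ P ∧ (∀ a : Fin d, ∃! c, c ∈ P ∧ a ∈ c) ∧ ∀ c ∈ P, Odd c.card

/-- The coefficients `ν(k)` of the exponential generating function
`log cosh(x) = Σ_k ν(k) x^k / k!`. -/
noncomputable def logCoshCoeff (k : ℕ) : ℝ :=
  iteratedDeriv k (fun x : ℝ => Real.log (Real.cosh x)) 0

structure IsPart {α : Type*} (s : Finset α) (P : Finset (Finset α)) : Prop where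
  sub : ∀ c ∈ P, c ⊆ s
  ne : ∀ c ∈ P, c.Nonempty
  cov : ∀ a ∈ s, ∃ c ∈ P, a ∈ c
  dis : ∀ c ∈ P, ∀ d ∈ P, ∀ x ∈ c, x ∈ d → c = d

noncomputable def parts {α : Type*} [Fintype α] (s : Finset α) : Finset (Finset (Finset α)) :=
  Finset.univ.filter (IsPart s)

theorem sum_parts_insert {α : Type*} [Fintype α] (s : Finset α) (a : α) (ha : a ∉ s)
    (w : Finset (Finset α) → ℝ) :
    ∑ P ∈ parts (insert a s), w P = ∑ P ∈ parts s,
      (w (insert {a} P) + ∑ c ∈ P, w (insert (insert a c) (P.erase c))) := by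
  rw [Finset.sum_add_distrib, ← Finset.sum_filter_add_sum_filter_not (parts (insert a s)) (fun P => {a} ∈ P)]
  have hna : ∀ P ∈ parts s, ∀ c ∈ P, a ∉ c := by
    intro P hP c hc hac
    simp only [parts, Finset.mem_filter] at hP
    exact ha (hP.2.sub c hc hac)
  congr 1
  · refine Finset.sum_bij' (fun P _ => P.erase {a}) (fun P _ => insert {a} P) ?_ ?_ ?_ ?_ ?_
    · intro P hP
      simp only [parts, Finset.mem_filter, Finset.mem_univ, true_and] at hP ⊢
      obtain ⟨⟨h1, h2, h3, h4⟩, h5⟩ := hP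
      refine ⟨?_, ?_, ?_, ?_⟩
      · intro c hc x hx
        have := h1 c (by grind) hx
        have := h4 c (by grind) {a} h5
        grind
      · grind
      · intro b hb
        obtain ⟨c, hc, hbc⟩ := h3 b (by grind)
        refine ⟨c, ?_, hbc⟩
        grind
      · intro c hc d hd
        exact h4 c (by grind) d (by grind)
    · intro P hP
      have hna := hna P hP
      simp only [parts, Finset.mem_filter, Finset.mem_univ, true_and] at hP ⊢
      obtain ⟨h1, h2, h3, h4⟩ := hP
      refine ⟨⟨?_, ?_, ?_, ?_⟩, by simp⟩
      · intro c hc x hx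
        rcases Finset.mem_insert.1 hc with rfl | hc
        · grind
        · have := h1 c hc hx
          grind
      · intro c hc
        rcases Finset.mem_insert.1 hc with rfl | hc
        · simp
        · exact h2 c hc
      · intro b hb
        rcases Finset.mem_insert.1 hb with rfl | hb
        · exact ⟨{b}, by simp, by simp⟩
        · obtain ⟨c, hc, hbc⟩ := h3 b hb
          exact ⟨c, by simp [hc], hbc⟩
      · intro c hc d hd x hx hxd
        grind
    · intro P hP
      simp only [Finset.mem_filter] at hP
      exact Finset.insert_erase hP.2
    · intro P hP
      exact Finset.erase_insert (fun h => hna P hP _ h (by simp))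
    · intro P hP
      simp only [Finset.mem_filter] at hP
      rw [Finset.insert_erase hP.2]
  · rw [Finset.sum_sigma']
    symm
    refine Finset.sum_bij (fun p _ => insert (insert a p.2) (p.1.erase p.2)) ?_ ?_ ?_ ?_
    · rintro ⟨P, c⟩ hp
      obtain ⟨hP, hc⟩ := Finset.mem_sigma.1 hp
      have hna := hna P hP
      simp only at hP hc
      simp only [parts, Finset.mem_filter, Finset.mem_univ, true_and] at hP ⊢
      obtain ⟨h1, h2, h3, h4⟩ := hP
      refine ⟨⟨?_, ?_, ?_, ?_⟩, ?_⟩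
      · intro e he x hx
        have := h1 c hc
        rcases Finset.mem_insert.1 he with rfl | he
        · grind
        · have := h1 e (Finset.mem_of_mem_erase he) hx
          grind
      · intro e he
        rcases Finset.mem_insert.1 he with rfl | he
        · simp
        · exact h2 e (Finset.mem_of_mem_erase he)
      · intro b hb
        rcases Finset.mem_insert.1 hb with rfl | hb
        · exact ⟨insert b c, by simp, by simp⟩
        · obtain ⟨e, he, hbe⟩ := h3 b hb
          by_cases hec : e = c
          · exact ⟨insert a c, by simp, by grind⟩
          · exact ⟨e, by simp [he, hec], hbe⟩
      · intro e he d hd x hx hxd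
        rcases Finset.mem_insert.1 he with rfl | he <;>
        rcases Finset.mem_insert.1 hd with rfl | hd
        · rfl
        · have := h4 c hc d (by grind) x
          grind
        · have := h4 c hc e (by grind) x
          grind
        · exact h4 e (by grind) d (by grind) x hx hxd
      · intro h
        rcases Finset.mem_insert.1 h with h | h
        · obtain ⟨x, hx⟩ := h2 c hc
          have : x ∈ ({a} : Finset α) := by rw [h]; grind
          have := hna c hc
          grind
        · exact hna {a} (by grind) (by simp)
    · rintro ⟨P, c⟩ hp ⟨P', c'⟩ hp' h
      obtain ⟨hP, hc⟩ := Finset.mem_sigma.1 hp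
      obtain ⟨hP', hc'⟩ := Finset.mem_sigma.1 hp'
      have h1 := hna P hP
      have h2 := hna P' hP'
      simp only at hc hc' h h1 h2
      have e1 : insert a c = insert a c' := by
        have : insert a c' ∈ insert (insert a c) (P.erase c) := by rw [h]; simp
        rcases Finset.mem_insert.1 this with h | h
        · exact h.symm
        · exact absurd (Finset.mem_insert_self a c') (h1 _ (Finset.mem_of_mem_erase h))
      have e2 : c = c' := by
        rw [← Finset.erase_insert (h1 c hc), e1, Finset.erase_insert (h2 c' hc')]
      subst e2
      have k1 : insert a c ∉ P.erase c := fun h => h1 _ (Finset.mem_of_mem_erase h) (by simp)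
      have k2 : insert a c ∉ P'.erase c := fun h => h2 _ (Finset.mem_of_mem_erase h) (by simp)
      have : P.erase c = P'.erase c := by
        rw [← Finset.erase_insert k1, h, Finset.erase_insert k2]
      have : P = P' := by rw [← Finset.insert_erase hc, this, Finset.insert_erase hc']
      subst this
      rfl
    · intro Q hQ
      simp only [parts, Finset.mem_filter, Finset.mem_univ, true_and] at hQ
      obtain ⟨⟨h1, h2, h3, h4⟩, h5⟩ := hQ
      obtain ⟨c, hc, hac⟩ := h3 a (by simp)
      have hca : (c.erase a).Nonempty := by
        by_contra hh
        rw [Finset.not_nonempty_iff_eq_empty] at hh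
        apply h5
        have : c = {a} := by rw [← Finset.insert_erase hac, hh]; rfl
        rwa [← this]
      have hnm : c.erase a ∉ Q.erase c := by
        intro h
        obtain ⟨x, hx⟩ := hca
        have := h4 _ (Finset.mem_of_mem_erase h) c hc x hx (Finset.mem_of_mem_erase hx)
        grind
      refine ⟨⟨insert (c.erase a) (Q.erase c), c.erase a⟩, ?_, ?_⟩
      · refine Finset.mem_sigma.2 ⟨?_, by simp⟩
        simp only [parts, Finset.mem_filter, Finset.mem_univ, true_and]
        refine ⟨?_, ?_, ?_, ?_⟩
        · intro e he x hx
          rcases Finset.mem_insert.1 he with rfl | he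
          · have := h1 c hc (Finset.mem_of_mem_erase hx)
            grind
          · have := h1 e (Finset.mem_of_mem_erase he) hx
            have := h4 e (Finset.mem_of_mem_erase he) c hc a
            grind
        · intro e he
          rcases Finset.mem_insert.1 he with rfl | he
          · exact hca
          · exact h2 e (Finset.mem_of_mem_erase he)
        · intro b hb
          obtain ⟨e, he, hbe⟩ := h3 b (by simp [hb])
          by_cases hec : e = c
          · exact ⟨c.erase a, by simp, by grind⟩
          · exact ⟨e, by simp [he, hec], hbe⟩
        · intro e he d hd x hx hxd
          rcases Finset.mem_insert.1 he with rfl | he <;>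
          rcases Finset.mem_insert.1 hd with rfl | hd
          · rfl
          · have := h4 c hc d (by grind) x (by grind) hxd
            grind
          · have := h4 c hc e (by grind) x (by grind) hx
            grind
          · exact h4 e (by grind) d (by grind) x hx hxd
      · simp only
        rw [Finset.erase_insert hnm, Finset.insert_erase hac, Finset.insert_erase hc]
    · intros; rfl

/-- the derivatives of `log cosh`, shifted by one -/
noncomputable def uFun (k : ℕ) (x : ℝ) : ℝ :=
  iteratedDeriv (k + 1) (fun x : ℝ => Real.log (Real.cosh x)) x

theorem contDiff_logCosh (n : ℕ) : ContDiff ℝ n (fun x : ℝ => Real.log (Real.cosh x)) :=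
  Real.contDiff_cosh.log (fun x => (Real.cosh_pos x).ne')

theorem hasDerivAt_uFun (k : ℕ) (x : ℝ) : HasDerivAt (uFun k) (uFun (k + 1) x) x := by
  have h : Differentiable ℝ (uFun k) :=
    (contDiff_logCosh (k + 2)).differentiable_iteratedDeriv (k + 1) (by norm_cast; omega)
  have := (h x).hasDerivAt
  have e : uFun (k + 1) x = deriv (uFun k) x := by
    unfold uFun
    rw [iteratedDeriv_succ]
  rwa [e]

theorem uFun_zero (x : ℝ) : uFun 0 x = Real.tanh x := by
  unfold uFun
  rw [zero_add, iteratedDeriv_one, Real.tanh_eq_sinh_div_cosh]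
  exact ((Real.hasDerivAt_cosh x).log (Real.cosh_pos x).ne').deriv

theorem hasDerivAt_tanh' (x : ℝ) : HasDerivAt Real.tanh (1 - Real.tanh x ^ 2) x := by
  have h := (Real.hasDerivAt_sinh x).div (Real.hasDerivAt_cosh x) (Real.cosh_pos x).ne'
  have e : Real.tanh = Real.sinh / Real.cosh := by
    ext y; simp [Real.tanh_eq_sinh_div_cosh]
  rw [e]
  convert! h using 1
  have := (Real.cosh_pos x).ne'
  simp only [Pi.div_apply]
  field_simp

theorem uFun_one (x : ℝ) : uFun 1 x = 1 - Real.tanh x ^ 2 := by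
  have h := hasDerivAt_uFun 0 x
  have e : uFun 0 = Real.tanh := funext uFun_zero
  rw [e] at h
  exact h.unique (hasDerivAt_tanh' x)

/-- the derivatives of `artanh`, evaluated at `tanh x` -/
noncomputable def dFun : ℕ → ℝ → ℝ
  | 0, x => x
  | k + 1, x => (k.factorial : ℝ) / 2 *
      (((1 - Real.tanh x) ^ (k + 1))⁻¹ + (-1) ^ k * ((1 + Real.tanh x) ^ (k + 1))⁻¹)

theorem hasDerivAt_dFun (k : ℕ) (x : ℝ) :
    HasDerivAt (dFun k) (dFun (k + 1) x * uFun 1 x) x := by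
  have h1 : 1 - Real.tanh x ≠ 0 := by linarith [Real.tanh_lt_one x]
  have h2 : 1 + Real.tanh x ≠ 0 := by linarith [Real.neg_one_lt_tanh x]
  rw [uFun_one]
  cases k with
  | zero =>
    have : dFun (0 + 1) x * (1 - Real.tanh x ^ 2) = 1 := by
      simp only [dFun]
      simp
      field_simp
      ring
    rw [this]
    exact hasDerivAt_id x
  | succ k =>
    have t := hasDerivAt_tanh' x
    have a1 := ((t.const_sub 1).fun_pow (k + 1)).fun_inv (pow_ne_zero _ h1)
    have a2 := ((t.const_add 1).fun_pow (k + 1)).fun_inv (pow_ne_zero _ h2)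
    have := (a1.fun_add (a2.const_mul ((-1 : ℝ) ^ k))).const_mul ((k.factorial : ℝ) / 2)
    convert! this using 1
    simp only [dFun, Nat.factorial_succ, add_tsub_cancel_right]
    push_cast
    field_simp
    ring

noncomputable def bFun {α : Type*} (P : Finset (Finset α)) (x : ℝ) : ℝ :=
  dFun P.card x * ∏ c ∈ P, uFun c.card x

theorem hasDerivAt_sum_bFun {α : Type*} [Fintype α] (s : Finset α) (a : α) (ha : a ∉ s) (x : ℝ) :
    HasDerivAt (fun x => ∑ P ∈ parts s, bFun P x) (∑ P ∈ parts (insert a s), bFun P x) x := by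
  rw [sum_parts_insert s a ha]
  refine HasDerivAt.fun_sum fun P hP => ?_
  have hna : ∀ c ∈ P, a ∉ c := by
    intro c hc hac
    simp only [parts, Finset.mem_filter] at hP
    exact ha (hP.2.sub c hc hac)
  have h := (hasDerivAt_dFun P.card x).fun_mul
    (HasDerivAt.fun_finsetProd (u := P) (f := fun c x => uFun c.card x)
      (fun c _ => hasDerivAt_uFun c.card x))
  convert! h using 1
  congr 1
  · have : {a} ∉ P := fun h => hna _ h (by simp)
    simp only [bFun]
    rw [Finset.card_insert_of_notMem this, Finset.prod_insert this]
    simp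
    ring
  · rw [Finset.mul_sum]
    refine Finset.sum_congr rfl fun c hc => ?_
    have : insert a c ∉ P.erase c := fun h => hna _ (Finset.mem_of_mem_erase h) (by simp)
    simp only [bFun]
    rw [Finset.card_insert_of_notMem this, Finset.prod_insert this,
      Finset.card_insert_of_notMem (hna c hc), Finset.card_erase_add_one hc, smul_eq_mul]
    ring

theorem sum_bFun {α : Type*} [Fintype α] (s : Finset α) :
    (fun x => ∑ P ∈ parts s, bFun P x) = iteratedDeriv s.card id := by
  induction s using Finset.induction_on with
  | empty =>
    have : parts (∅ : Finset α) = {∅} := by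
      ext P
      simp only [parts, Finset.mem_filter, Finset.mem_univ, true_and, Finset.mem_singleton]
      constructor
      · rintro ⟨h1, h2, -, -⟩
        rw [Finset.eq_empty_iff_forall_notMem]
        intro c hc
        obtain ⟨x, hx⟩ := h2 c hc
        simpa using h1 c hc hx
      · rintro rfl
        constructor <;> simp
    ext x
    simp [this, bFun, dFun]
  | insert a s ha ih =>
    rw [Finset.card_insert_of_notMem ha, iteratedDeriv_succ, ← ih]
    ext x
    exact (hasDerivAt_sum_bFun s a ha x).deriv.symm

theorem logCoshCoeff_odd (k : ℕ) (hk : Odd k) : logCoshCoeff k = 0 := by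
  have h := iteratedDeriv_comp_neg k (fun x : ℝ => Real.log (Real.cosh x)) 0
  simp only [Real.cosh_neg, hk.neg_one_pow, neg_zero] at h
  unfold logCoshCoeff
  simp only [smul_eq_mul] at h
  linarith

theorem logCoshCoeff_two : logCoshCoeff 2 = 1 := by
  have := uFun_one 0
  simpa [uFun, logCoshCoeff] using this

theorem IsOddPartition.isPart {d : ℕ} {P : Finset (Finset (Fin d))} (h : IsOddPartition d P) :
    IsPart Finset.univ P := by
  obtain ⟨h1, h2, h3⟩ := h
  refine ⟨fun c _ => Finset.subset_univ c, ?_, ?_, ?_⟩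
  · intro c hc
    exact Finset.card_pos.1 (h3 c hc).pos
  · intro a _
    obtain ⟨c, hc, -⟩ := h2 a
    exact ⟨c, hc.1, hc.2⟩
  · intro c hc e he x hx hxe
    exact (h2 x).unique ⟨hc, hx⟩ ⟨he, hxe⟩

theorem IsPart.isOdd {d : ℕ} {P : Finset (Finset (Fin d))} (h : IsPart Finset.univ P)
    (h' : ∀ c ∈ P, Odd c.card) : IsOddPartition d P := by
  refine ⟨fun he => by simpa using h.ne _ he, fun a => ?_, h'⟩
  obtain ⟨c, hc, hac⟩ := h.cov a (Finset.mem_univ a)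
  exact ⟨c, ⟨hc, hac⟩, fun e he => h.dis e he.1 c hc a he.2 hac⟩

theorem IsPart.sum_card {d : ℕ} {P : Finset (Finset (Fin d))} (h : IsPart Finset.univ P) :
    ∑ c ∈ P, c.card = d := by
  have h1 := Finset.card_biUnion (s := P) (t := id) (by
    intro c hc e he hce
    rw [Function.onFun, Finset.disjoint_left]
    intro x hx hxe
    exact hce (h.dis c hc e he x hx hxe))
  have h2 : P.biUnion id = Finset.univ := by
    ext x
    simpa using h.cov x (Finset.mem_univ x)
  rw [h2] at h1
  simpa using h1.symm

theorem IsOddPartition.odd_card {d : ℕ} (hd : Odd d) {P : Finset (Finset (Fin d))}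
    (h : IsOddPartition d P) : Odd P.card := by
  have h1 := h.isPart.sum_card
  rw [← h1, Finset.odd_sum_iff_odd_card_odd, Finset.filter_true_of_mem h.2.2] at hd
  exact hd

theorem dFun_zero_odd (k : ℕ) (hk : Odd k) : dFun k 0 = ((k - 1).factorial : ℝ) := by
  obtain ⟨j, rfl⟩ := hk
  simp [dFun]
  ring

theorem sum_odd_parts (d : ℕ) (hd : Odd d) :
    ∑ P ∈ Finset.univ.filter (IsOddPartition d),
      ((P.card - 1).factorial : ℝ) * ∏ c ∈ P, logCoshCoeff (c.card + 1) =
        if d = 1 then 1 else 0 := by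
  have h := congrFun (sum_bFun (Finset.univ : Finset (Fin d))) 0
  rw [iteratedDeriv_id] at h
  have hd0 : d ≠ 0 := hd.pos.ne'
  simp only [Finset.card_univ, Fintype.card_fin, hd0, if_false] at h
  rw [← h]
  have hsub : Finset.univ.filter (IsOddPartition d) ⊆ parts (Finset.univ : Finset (Fin d)) := by
    intro P hP
    simp only [parts, Finset.mem_filter, Finset.mem_univ, true_and] at hP ⊢
    exact hP.isPart
  rw [← Finset.sum_subset hsub]
  · refine Finset.sum_congr rfl fun P hP => ?_
    simp only [Finset.mem_filter, Finset.mem_univ, true_and] at hP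
    rw [bFun, dFun_zero_odd _ (hP.odd_card hd)]
    rfl
  · intro P hP hP'
    simp only [parts, Finset.mem_filter, Finset.mem_univ, true_and] at hP hP'
    have : ∃ c ∈ P, ¬ Odd c.card := by
      by_contra! hc
      exact hP' (hP.isOdd hc)
    obtain ⟨c, hc, hcc⟩ := this
    rw [bFun, Finset.prod_eq_zero hc, mul_zero]
    exact logCoshCoeff_odd _ (by grind)

theorem sum_odd_parts_one (d : ℕ) (hd : Odd d) :
    ∑ P ∈ Finset.univ.filter (IsOddPartition d),
      (if P.card = 1 then (1 : ℝ) else 0) * ∏ c ∈ P, logCoshCoeff (c.card + 1) =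
        logCoshCoeff (d + 1) := by
  have hmem : IsOddPartition d {Finset.univ} := by
    have := hd.pos
    refine ⟨?_, fun a => ⟨Finset.univ, by simp, by simp⟩, by simpa using hd⟩
    rw [Finset.mem_singleton]
    exact (Finset.univ_nonempty_iff.2 ⟨⟨0, this⟩⟩).ne_empty.symm
  rw [Finset.sum_eq_single {Finset.univ}]
  · simp
  · intro P hP hne
    simp only [Finset.mem_filter, Finset.mem_univ, true_and] at hP
    rw [if_neg, zero_mul]
    intro hc
    obtain ⟨c, rfl⟩ := Finset.card_eq_one.1 hc
    apply hne
    congr 1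
    ext x
    simpa using hP.isPart.cov x (Finset.mem_univ x)
  · intro hn
    simp [hmem] at hn

/-- Let `ν` be the log-cosh coefficients and suppose `μstar : ℕ → ℝ` satisfies
`μstar 2 = −1` together with the recursion
`2ν(m) = 1{m=2} + Σ_{π ∈ Part([m−1]; odd)} (−μstar(|π|+1)) ∏_{S∈π} ν(|S|+1)` for all even
`m ≥ 2`.  Then `μstar m = (m−2)!` for all even `m ≥ 4`. -/
theorem mustar_eq_factorial
    (μstar : ℕ → ℝ) (h2 : μstar 2 = -1)
    (hrec : ∀ m : ℕ, Even m → 2 ≤ m →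
      2 * logCoshCoeff m =
        (if m = 2 then (1 : ℝ) else 0) +
          ∑ P ∈ Finset.univ.filter (IsOddPartition (m - 1)),
            (-(μstar (P.card + 1))) * ∏ c ∈ P, logCoshCoeff (c.card + 1)) :
    ∀ m : ℕ, Even m → 4 ≤ m → μstar m = ((m - 2).factorial : ℝ) := by
  intro m
  induction m using Nat.strong_induction_on with
  | _ m ih =>
  intro hm hm4
  obtain ⟨d, rfl⟩ : ∃ d, m = d + 1 := ⟨m - 1, by omega⟩
  have hd : Odd d := by grind
  have hr : 2 * logCoshCoeff (d + 1) =
        (if d + 1 = 2 then (1 : ℝ) else 0) +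
          ∑ P ∈ Finset.univ.filter (IsOddPartition d),
            (-(μstar (P.card + 1))) * ∏ c ∈ P, logCoshCoeff (c.card + 1) :=
    hrec (d + 1) hm (by omega)
  rw [if_neg (by omega), zero_add] at hr
  have e1 := sum_odd_parts d hd
  rw [if_neg (by omega)] at e1
  have e2 := sum_odd_parts_one d hd
  have key : ∑ P ∈ Finset.univ.filter (IsOddPartition d),
      (((P.card - 1).factorial : ℝ) - 2 * (if P.card = 1 then (1 : ℝ) else 0)
        - μstar (P.card + 1)) * ∏ c ∈ P, logCoshCoeff (c.card + 1) = 0 := by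
    have : ∀ P : Finset (Finset (Fin d)),
      (((P.card - 1).factorial : ℝ) - 2 * (if P.card = 1 then (1 : ℝ) else 0)
        - μstar (P.card + 1)) * ∏ c ∈ P, logCoshCoeff (c.card + 1) =
      ((P.card - 1).factorial : ℝ) * ∏ c ∈ P, logCoshCoeff (c.card + 1)
      - 2 * ((if P.card = 1 then (1 : ℝ) else 0) * ∏ c ∈ P, logCoshCoeff (c.card + 1))
      + (-(μstar (P.card + 1))) * ∏ c ∈ P, logCoshCoeff (c.card + 1) := by
      intro P; ring
    simp_rw [this]
    rw [Finset.sum_add_distrib, Finset.sum_sub_distrib, ← Finset.mul_sum, e1, e2, ← hr]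
    ring
  have hterm : ∀ P ∈ Finset.univ.filter (IsOddPartition d),
      (((P.card - 1).factorial : ℝ) - 2 * (if P.card = 1 then (1 : ℝ) else 0)
        - μstar (P.card + 1)) * ∏ c ∈ P, logCoshCoeff (c.card + 1) =
      if P.card = d then ((d - 1).factorial : ℝ) - μstar (d + 1) else 0 := by
    intro P hP
    simp only [Finset.mem_filter, Finset.mem_univ, true_and] at hP
    have ho := hP.odd_card hd
    have hs := hP.isPart.sum_card
    have hpos : ∀ c ∈ P, 1 ≤ c.card := fun c hc => (hP.2.2 c hc).pos
    have hle : P.card ≤ d := by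
      calc P.card = ∑ c ∈ P, 1 := Finset.card_eq_sum_ones P
        _ ≤ ∑ c ∈ P, c.card := Finset.sum_le_sum hpos
        _ = d := hs
    split_ifs with h1 h3 h3
    · omega
    · rw [h1, h2]; norm_num
    · have hone : ∀ c ∈ P, 1 = c.card := by
        rw [← Finset.sum_eq_sum_iff_of_le hpos, hs, ← Finset.card_eq_sum_ones, h3]
      rw [h3, Finset.prod_eq_one]
      · ring
      · intro c hc
        rw [← hone c hc]
        exact logCoshCoeff_two
    · rw [ih (P.card + 1) (by omega) (by grind) (by grind)]
      have : P.card + 1 - 2 = P.card - 1 := by omega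
      rw [this]; ring
  rw [Finset.sum_congr rfl hterm, ← Finset.sum_filter, Finset.sum_const, nsmul_eq_mul,
    mul_eq_zero] at key
  have hne : ((Finset.univ.filter (IsOddPartition d)).filter
      (fun P => P.card = d)).card ≠ 0 := by
    rw [Finset.card_ne_zero]
    refine ⟨Finset.univ.image (fun a => ({a} : Finset (Fin d))), ?_⟩
    simp only [Finset.mem_filter, Finset.mem_univ, true_and]
    refine ⟨⟨by simp, fun a => ⟨{a}, by simp, ?_⟩, by simp⟩, ?_⟩
    · rintro c ⟨hc, hac⟩
      obtain ⟨b, -, rfl⟩ := Finset.mem_image.1 hc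
      simp at hac
      rw [hac]
    · rw [Finset.card_image_of_injective _ Finset.singleton_injective]
      simp
  have := key.resolve_left (by exact_mod_cast hne)
  have e : d + 1 - 2 = d - 1 := by omega
  rw [e]
  linarith
end
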